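/- arXiv:2506.11450 — 5 statements merged into one kernel-verified Lean document; each statement's English description precedes it below -/
import Mathlib

section
/- (Criterion for existence of full-rank multiplication.) Let r ≥ 0, β = (a,b) ample, f ∈ S_β nondegenerate, K = (−r−2,−2). Assume dim_ℂ R₁(f)_{3β+2K} = 1 and that the multiplication pairings R₁(f)_{β+K} × R₁(f)_{2β+K} → R₁(f)_{3β+2K} and R₁(f)_β × R₁(f)_{2β+2K} → R₁(f)_{3β+2K} are nondegenerate. If the only α ∈ R₁(f)_{β+K} with α² = 0 in R₁(f)_{2β+2K} is α = 0, then there exists η ∈ R₁(f)_β such that the multiplication map R₁(f)_{β+K} → R₁(f)_{2β+K}, x ↦ η·x, is injective (i.e., has rank g = dim_ℂ R₁(f)_{β+K}). -/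
open MvPolynomial

noncomputable section

/-- The Cox ring of the Hirzebruch surface: `ℂ[x₁,x₂,x₃,x₄]`. -/
abbrev S : Type := MvPolynomial (Fin 4) ℂ

/-- The ℤ²-degree of a monomial exponent vector for the Hirzebruch grading:
`deg x₁ = deg x₃ = (1,0)`, `deg x₂ = (0,1)`, `deg x₄ = (r,1)`. -/
def wdeg (r : ℕ) (c : Fin 4 →₀ ℕ) : ℤ × ℤ :=
  ((c 0 : ℤ) + (c 2 : ℤ) + (r : ℤ) * (c 3 : ℤ), (c 1 : ℤ) + (c 3 : ℤ))

/-- The graded piece `S_γ`: the span of monomials of degree `γ`. -/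
def Sgr (r : ℕ) (γ : ℤ × ℤ) : Submodule ℂ S where
  carrier := {f : S | ∀ c ∈ f.support, wdeg r c = γ}
  add_mem' := by
    intro f g hf hg c hc
    rcases Finset.mem_union.mp (MvPolynomial.support_add hc) with h | h
    · exact hf c h
    · exact hg c h
  zero_mem' := by
    intro c hc
    simp at hc
  smul_mem' := by
    intro t f hf c hc
    exact hf c (MvPolynomial.support_smul hc)

/-- The ideal `J₀(f)`, generated by `xᵢ ∂f/∂xᵢ`, `i = 1,…,4`. -/
def J0 (f : S) : Ideal S :=
  Ideal.span {g : S | ∃ i : Fin 4, g = X i * pderiv i f}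

/-- The ideal quotient `J₁(f) = J₀(f) : (x₁x₂x₃x₄)`. -/
def J1 (f : S) : Ideal S :=
  Submodule.colon (J0 f) (Ideal.span {(X 0 * X 1 * X 2 * X 3 : S)})

/-- The exceptional set `Z(Σ)` of the quotient construction of the Hirzebruch surface. -/
def Zexc : Set (Fin 4 → ℂ) :=
  {p | p 2 * p 3 = 0 ∧ p 0 * p 3 = 0 ∧ p 0 * p 1 = 0 ∧ p 1 * p 2 = 0}

/-- `f` is nondegenerate: `x₁∂f/∂x₁, …, x₄∂f/∂x₄` have no common zero outside `Z(Σ)`. -/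
def Nondeg (f : S) : Prop :=
  ∀ p : Fin 4 → ℂ, p ∉ Zexc → ∃ i : Fin 4, eval p (X i * pderiv i f) ≠ 0

/-- The graded piece `R₁(f)_γ = S_γ/(J₁(f) ∩ S_γ)`, realized as the image of `S_γ`
in the quotient ring `S ⧸ J₁(f)`. -/
def R1 (r : ℕ) (f : S) (γ : ℤ × ℤ) : Submodule ℂ (S ⧸ J1 f) :=
  (Sgr r γ).map (Ideal.Quotient.mkₐ ℂ (J1 f)).toLinearMap

/-- Nondegeneracy (on both sides) of the multiplication pairing
`R₁(f)_γ × R₁(f)_γ' → R₁(f)_{γ+γ'}`, stated elementwise: a class `[x]` is nonzero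
iff `x ∉ J₁(f)`, and the pairing of `[x]` and `[y]` is nonzero iff `x*y ∉ J₁(f)`. -/
def NondegPair (r : ℕ) (f : S) (γ γ' : ℤ × ℤ) : Prop :=
  (∀ x ∈ Sgr r γ, x ∉ J1 f → ∃ y ∈ Sgr r γ', x * y ∉ J1 f) ∧
  (∀ y ∈ Sgr r γ', y ∉ J1 f → ∃ x ∈ Sgr r γ, x * y ∉ J1 f)
/-- Among the linear maps `B + t • C`, let `B` have maximal rank. Then `C` maps `ker B` into
`range B`. -/
lemma mem_range_of_finrank_range_le {K V U : Type*} [Field K] [Infinite K]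
    [AddCommGroup V] [Module K V] [FiniteDimensional K V] [AddCommGroup U] [Module K U]
    (B C : V →ₗ[K] U)
    (hmax : ∀ t : K, Module.finrank K (B + t • C).range ≤ Module.finrank K B.range)
    {x : V} (hx : B x = 0) : C x ∈ B.range := by
  by_contra hCx
  obtain ⟨s, hs⟩ := B.rangeRestrict.exists_rightInverse_of_surjective B.range_rangeRestrict
  have hBs : ∀ m, B (s m) = m := fun m ↦ congrArg Subtype.val (LinearMap.congr_fun hs m)
  let G : (B.range × K) →ₗ[K] U := B.range.subtype.coprod (LinearMap.toSpanSingleton K U (C x))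
  have hG : LinearMap.ker G = ⊥ := by
    rw [LinearMap.ker_eq_bot']
    rintro ⟨m, c⟩ h
    have h' : (m : U) + c • C x = 0 := h
    have hc : c = 0 := by
      by_contra hc
      have h1 : c • C x ∈ B.range := by
        rw [eq_neg_of_add_eq_zero_right h']
        exact neg_mem m.2
      exact hCx ((B.range.smul_mem_iff hc).1 h1)
    subst hc
    simpa using h'
  obtain ⟨P, hP⟩ := G.exists_leftInverse_of_injective hG
  let D : (B.range × K) →ₗ[K] U := C ∘ₗ s ∘ₗ LinearMap.fst K _ _
  obtain ⟨μ, hμ⟩ := ((Module.End.finite_hasEigenvalue (P ∘ₗ D)).union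
    (Set.finite_singleton (0 : K))).exists_notMem
  simp only [Set.mem_union, Set.mem_singleton_iff, not_or] at hμ
  obtain ⟨hev, hμ0⟩ := hμ
  set t : K := -μ⁻¹ with ht
  have ht0 : t ≠ 0 := neg_ne_zero.2 (inv_ne_zero hμ0)
  have hinj : Function.Injective (G + t • D) := by
    rw [← LinearMap.ker_eq_bot, LinearMap.ker_eq_bot']
    intro z hz
    by_contra hz0
    refine hev (Module.End.hasEigenvalue_of_hasEigenvector (x := z)
      ⟨Module.End.mem_eigenspace_iff.2 ?_, hz0⟩)
    have h1 : z + t • P (D z) = 0 := by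
      have h2 := congrArg P hz
      have h3 : P (G z) = z := LinearMap.congr_fun hP z
      simpa [h3] using h2
    have h4 : μ • (z + t • P (D z)) = μ • z - P (D z) := by
      rw [smul_add, smul_smul, ht, mul_neg, mul_inv_cancel₀ hμ0, neg_one_smul, sub_eq_add_neg]
    rw [h1, smul_zero] at h4
    exact (sub_eq_zero.1 h4.symm).symm
  have hle : (G + t • D).range ≤ (B + t • C).range := by
    rintro _ ⟨⟨m, c⟩, rfl⟩
    refine ⟨s m + (t⁻¹ * c) • x, ?_⟩
    have h5 : t⁻¹ * c * t = c := by field_simp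
    simp only [G, D, LinearMap.add_apply, LinearMap.smul_apply, map_add, map_smul, hBs, hx,
      smul_zero, smul_add, smul_smul, LinearMap.coprod_apply, LinearMap.comp_apply,
      Submodule.subtype_apply, LinearMap.toSpanSingleton_apply, LinearMap.fst_apply]
    abel_nf
    rw [h5]
  have h6 := Submodule.finrank_mono hle
  rw [LinearMap.finrank_range_of_inj hinj, Module.finrank_prod, Module.finrank_self] at h6
  have := hmax t
  omega

/-- Each graded piece of the Cox ring is finite-dimensional. -/
lemma finiteDimensional_Sgr (r : ℕ) (γ : ℤ × ℤ) : FiniteDimensional ℂ (Sgr r γ) := by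
  have hfin : {c : Fin 4 →₀ ℕ | wdeg r c = γ}.Finite := by
    refine (Set.finite_Iic
      (Finsupp.equivFunOnFinite.symm fun _ ↦ γ.1.toNat + γ.2.toNat)).subset ?_
    rintro c rfl i
    have h : (0 : ℤ) ≤ r * c 3 := by positivity
    simp only [wdeg, Finsupp.equivFunOnFinite_symm_apply_apply]
    fin_cases i <;> simp <;> omega
  have : Finite {c : Fin 4 →₀ ℕ | wdeg r c = γ} := hfin
  have : FiniteDimensional ℂ (restrictSupport ℂ {c : Fin 4 →₀ ℕ | wdeg r c = γ}) :=
    (basisRestrictSupport ℂ _).finiteDimensional_of_finite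
  exact Submodule.finiteDimensional_of_le
    (S₂ := restrictSupport ℂ {c : Fin 4 →₀ ℕ | wdeg r c = γ})
    fun p hp ↦ (mem_restrictSupport_iff ℂ).2 fun c hc ↦ hp c hc

lemma mul_mem_Sgr {r : ℕ} {γ δ : ℤ × ℤ} {p q : S} (hp : p ∈ Sgr r γ) (hq : q ∈ Sgr r δ) :
    p * q ∈ Sgr r (γ + δ) := by
  classical
  intro c hc
  obtain ⟨u, hu, v, hv, rfl⟩ := Finset.mem_add.1 (support_mul p q hc)
  rw [← hp u hu, ← hq v hv]
  ext <;> simp [wdeg] <;> ring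

/-- Criterion for existence of full-rank multiplication: if the only
`α ∈ R₁(f)_{β+K}` with `α² = 0` in `R₁(f)_{2β+2K}` is `α = 0`, then there exists
`η ∈ R₁(f)_β` (represented by `η ∈ S_β`) such that the multiplication map
`R₁(f)_{β+K} → R₁(f)_{2β+K}`, `x ↦ η·x`, is injective (stated elementwise), i.e.
has rank `g = dim_ℂ R₁(f)_{β+K}`. -/
theorem stmt_10 (r : ℕ) (a b : ℤ) (hβ : (r : ℤ) * b < a ∧ 0 < b)
    (f : S) (hf : f ∈ Sgr r (a, b)) (hnd : Nondeg f)
    (h3 : Module.finrank ℂ ↥(R1 r f (3 * a - 2 * r - 4, 3 * b - 4)) = 1)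
    (hp1 : NondegPair r f (a - r - 2, b - 2) (2 * a - r - 2, 2 * b - 2))
    (hp2 : NondegPair r f (a, b) (2 * a - 2 * r - 4, 2 * b - 4))
    (hsq : ∀ α ∈ Sgr r (a - r - 2, b - 2), α * α ∈ J1 f → α ∈ J1 f) :
    ∃ η ∈ Sgr r (a, b),
      ∀ α ∈ Sgr r (a - r - 2, b - 2), η * α ∈ J1 f → α ∈ J1 f := by
  have := finiteDimensional_Sgr r (a - r - 2, b - 2)
  let V := Sgr r (a - r - 2, b - 2)
  let mulBy : S → V →ₗ[ℂ] S ⧸ J1 f := fun η ↦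
    (Ideal.Quotient.mkₐ ℂ (J1 f)).toLinearMap ∘ₗ LinearMap.mulLeft ℂ η ∘ₗ V.subtype
  have hmk : ∀ η (α : V), mulBy η α = Ideal.Quotient.mk (J1 f) (η * α) := fun _ _ ↦ rfl
  let ranks : Set ℕ := (fun η ↦ Module.finrank ℂ (mulBy η).range) '' (Sgr r (a, b) : Set S)
  have hbdd : BddAbove ranks := by
    refine ⟨Module.finrank ℂ V, ?_⟩
    rintro _ ⟨η, -, rfl⟩
    exact (mulBy η).finrank_range_le
  obtain ⟨η, hη, hmax⟩ := Nat.sSup_mem (s := ranks) ⟨_, 0, zero_mem _, rfl⟩ hbdd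
  refine ⟨η, hη, fun α hα hηα ↦ hsq α hα ?_⟩
  by_contra hαα
  have hdeg : α * α ∈ Sgr r (2 * a - 2 * r - 4, 2 * b - 4) := by
    convert mul_mem_Sgr hα hα using 2
    ext <;> simp <;> ring
  obtain ⟨θ, hθ, hne⟩ := hp2.2 _ hdeg hαα
  have hrange : mulBy θ ⟨α, hα⟩ ∈ (mulBy η).range := by
    refine mem_range_of_finrank_range_le _ _ (fun t ↦ ?_) ?_
    · have hadd : mulBy η + t • mulBy θ = mulBy (η + t • θ) := by
        ext x
        simp only [mulBy, LinearMap.comp_apply, LinearMap.add_apply, LinearMap.smul_apply,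
          LinearMap.mulLeft_apply, add_mul, smul_mul_assoc, map_add, map_smul]
      rw [hadd]
      exact (le_csSup hbdd ⟨_, add_mem hη ((Sgr r (a, b)).smul_mem t hθ), rfl⟩).trans hmax.ge
    · rw [hmk]
      exact Ideal.Quotient.eq_zero_iff_mem.2 hηα
  obtain ⟨y, hy⟩ := hrange
  rw [hmk, hmk, Ideal.Quotient.eq] at hy
  refine hne ?_
  have h1 : θ * (α * α) = (η * α) * y - (η * y - θ * α) * α := by ring
  rw [h1]
  exact sub_mem (Ideal.mul_mem_right _ _ hηα) (Ideal.mul_mem_right _ _ hy)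
end
end

section
/- Let r ≥ 0, β = (a,b) ample, f ∈ S_β nondegenerate, and let p ∈ ℂ⁴ with p ∉ Z(Σ), f(p) = 0, and ∂f/∂xᵢ(p) ≠ 0 for all i = 1,2,3,4. Then p₂ ≠ 0 and p₄ ≠ 0, and moreover p₁ ≠ 0 or p₃ ≠ 0. -/
open MvPolynomial

noncomputable section

/-- A polynomial of bidegree `(a, b)` is weighted homogeneous of degree `b` for the weights
of the second component of the grading. -/
lemma isWeightedHomogeneous_of_mem_Sgr {r : ℕ} {a b : ℤ} {f : S} (hf : f ∈ Sgr r (a, b)) :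
    f.IsWeightedHomogeneous (![0, 1, 0, 1] : Fin 4 → ℕ) b.toNat := by
  intro c hc
  have h : (c 1 : ℤ) + (c 3 : ℤ) = b :=
    congrArg Prod.snd (hf c (mem_support_iff.mpr hc))
  rw [Finsupp.weight_apply, Finsupp.sum_fintype _ _ (by simp)]
  simp [Fin.sum_univ_four]
  omega

/-- The Euler relation for the second component of the grading. -/
lemma X_mul_pderiv_add_of_mem_Sgr {r : ℕ} {a b : ℤ} {f : S} (hf : f ∈ Sgr r (a, b)) :
    X 1 * pderiv 1 f + X 3 * pderiv 3 f = b.toNat • f := by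
  simpa [Fin.sum_univ_four] using
    (isWeightedHomogeneous_of_mem_Sgr hf).sum_weight_X_mul_pderiv

/-- if `p ∉ Z(Σ)`, `f(p) = 0`, and all four partials of `f` are
nonzero at `p`, then `p₂ ≠ 0`, `p₄ ≠ 0`, and `p₁ ≠ 0` or `p₃ ≠ 0`.
(Variables are indexed `x₁,…,x₄ ↦ 0,…,3`.) -/
theorem stmt_11 (r : ℕ) (a b : ℤ) (hβ : (r : ℤ) * b < a ∧ 0 < b)
    (f : S) (hf : f ∈ Sgr r (a, b)) (hnd : Nondeg f)
    (p : Fin 4 → ℂ) (hp : p ∉ Zexc) (hfp : eval p f = 0)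
    (hder : ∀ i : Fin 4, eval p (pderiv i f) ≠ 0) :
    p 1 ≠ 0 ∧ p 3 ≠ 0 ∧ (p 0 ≠ 0 ∨ p 2 ≠ 0) := by
  have euler : p 1 * eval p (pderiv 1 f) + p 3 * eval p (pderiv 3 f) = 0 := by
    simpa [hfp] using congrArg (eval p) (X_mul_pderiv_add_of_mem_Sgr hf)
  refine ⟨fun h1 => hp ?_, fun h3 => hp ?_, ?_⟩
  · have h3 : p 3 = 0 := by simpa [h1, hder 3] using euler
    simp [Zexc, h1, h3]
  · have h1 : p 1 = 0 := by simpa [h3, hder 1] using euler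
    simp [Zexc, h1, h3]
  · by_contra! h
    exact hp (by simp [Zexc, h.1, h.2])
end
end

section
/- (Birationality of the linear system J₁(f)_β, injectivity part.) Let r ≥ 0, β = (a,b) ample, and f ∈ S_β nondegenerate. Let p, q ∈ ℂ⁴ ∖ Z(Σ) satisfy f(p) = f(q) = 0 and ∂f/∂xᵢ(p) ≠ 0 and ∂f/∂xᵢ(q) ≠ 0 for all i = 1,2,3,4. If there exists c ∈ ℂ* such that h(q) = c·h(p) for every h ∈ J₁(f) ∩ S_β, then p and q lie in the same G-orbit: there exist λ, μ ∈ ℂ* with q = (λp₁, μp₂, λp₃, λ^r μ p₄). (Hence the morphism induced by the base-point-free linear system J₁(f)_β restricted to the curve {f = 0} ⊂ ℋ_r is birational onto its image.) -/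
open MvPolynomial

noncomputable section

theorem wdeg_add (r : ℕ) (d e : Fin 4 →₀ ℕ) : wdeg r (d + e) = wdeg r d + wdeg r e := by
  ext <;> simp only [wdeg, Finsupp.add_apply, Prod.fst_add, Prod.snd_add] <;> push_cast <;> ring

theorem mul_pderiv_mem_J1 (u f : S) (i : Fin 4) : u * pderiv i f ∈ J1 f := by
  have hgen : X i * pderiv i f ∈ J0 f := Ideal.subset_span ⟨i, rfl⟩
  obtain ⟨v, hv⟩ : (X i : S) ∣ X 0 * X 1 * X 2 * X 3 := by
    rw [← Fin.prod_univ_four (X : Fin 4 → S)]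
    exact Finset.dvd_prod_of_mem _ (Finset.mem_univ i)
  refine Ideal.mem_colon_span_singleton.mpr ?_
  rw [hv, show u * pderiv i f * (X i * v) = u * v * (X i * pderiv i f) by ring]
  exact Ideal.mul_mem_left _ _ hgen

/-- Replacing `xᵢ` in the Euler field `xᵢ∂ᵢ` by a monomial of the same degree preserves `S_γ`. -/
theorem monomial_mul_pderiv_mem_Sgr {r : ℕ} {γ : ℤ × ℤ} {f : S} (hf : f ∈ Sgr r γ)
    {e : Fin 4 →₀ ℕ} {i : Fin 4} (he : wdeg r e = wdeg r (Finsupp.single i 1)) :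
    monomial e (1 : ℂ) * pderiv i f ∈ Sgr r γ := by
  intro d hd
  rw [mem_support_iff, coeff_monomial_mul'] at hd
  obtain ⟨hle, hd⟩ := ite_ne_right_iff.mp hd
  rw [one_mul, coeff_pderiv] at hd
  have hdeg := hf _ (mem_support_iff.mpr (left_ne_zero_of_mul hd))
  rwa [wdeg_add, ← he, ← wdeg_add, tsub_add_cancel_of_le hle] at hdeg

/-- Birationality of the linear system `J₁(f)_β`, injectivity part:
if `p, q ∈ ℂ⁴ ∖ Z(Σ)` are zeros of `f` at which all four partials of `f` are
nonzero, and all `h ∈ J₁(f) ∩ S_β` satisfy `h(q) = c·h(p)` for a fixed `c ∈ ℂ*`,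
then `p` and `q` lie in the same `G`-orbit:
`q = (λp₁, μp₂, λp₃, λ^r μ p₄)` for some `λ, μ ∈ ℂ*`. -/
theorem stmt_12 (r : ℕ) (a b : ℤ) (hβ : (r : ℤ) * b < a ∧ 0 < b)
    (f : S) (hf : f ∈ Sgr r (a, b)) (hnd : Nondeg f)
    (p q : Fin 4 → ℂ) (hp : p ∉ Zexc) (hq : q ∉ Zexc)
    (hfp : eval p f = 0) (hfq : eval q f = 0)
    (hderp : ∀ i : Fin 4, eval p (pderiv i f) ≠ 0)
    (hderq : ∀ i : Fin 4, eval q (pderiv i f) ≠ 0)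
    (c : ℂ) (hc : c ≠ 0)
    (hch : ∀ h : S, h ∈ J1 f → h ∈ Sgr r (a, b) → eval q h = c * eval p h) :
    ∃ lam mu : ℂ, lam ≠ 0 ∧ mu ≠ 0 ∧
      q 0 = lam * p 0 ∧ q 1 = mu * p 1 ∧ q 2 = lam * p 2 ∧
      q 3 = lam ^ r * mu * p 3 := by
  have key : ∀ (e : Fin 4 → ℕ) (i : Fin 4),
      wdeg r (Finsupp.equivFunOnFinite.symm e) = wdeg r (Finsupp.single i 1) →
      (∏ j, q j ^ e j) * eval q (pderiv i f) = c * ((∏ j, p j ^ e j) * eval p (pderiv i f)) := by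
    intro e i he
    simpa [eval_monomial, Finsupp.prod_fintype] using
      hch _ (mul_pderiv_mem_J1 _ f i) (monomial_mul_pderiv_mem_Sgr hf he)
  have k00 := key ![1, 0, 0, 0] 0 (by simp [wdeg])
  have k20 := key ![0, 0, 1, 0] 0 (by simp [wdeg])
  have k11 := key ![0, 1, 0, 0] 1 (by simp [wdeg])
  have k33 := key ![0, 0, 0, 1] 3 (by simp [wdeg])
  have k03 := key ![r, 1, 0, 0] 3 (by simp [wdeg])
  have k23 := key ![0, 1, r, 0] 3 (by simp [wdeg])
  simp [Fin.prod_univ_four] at k00 k20 k11 k33 k03 k23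
  have scale : ∀ (i : Fin 4) (x y : ℂ),
      y * eval q (pderiv i f) = c * (x * eval p (pderiv i f)) →
      y = c * eval p (pderiv i f) / eval q (pderiv i f) * x := by
    intro i x y h
    rw [div_mul_eq_mul_div, eq_div_iff (hderq i), h]
    ring
  have scale_ne : ∀ i : Fin 4, c * eval p (pderiv i f) / eval q (pderiv i f) ≠ 0 := fun i ↦
    div_ne_zero (mul_ne_zero hc (hderp i)) (hderq i)
  have h0 := scale 0 _ _ k00
  have h2 := scale 0 _ _ k20
  have h1 := scale 1 _ _ k11
  have h3 := scale 3 _ _ k33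
  have h03 := scale 3 _ _ k03
  have h23 := scale 3 _ _ k23
  have hlam := scale_ne 0
  have hmu := scale_ne 1
  have hnu := scale_ne 3
  generalize c * eval p (pderiv 0 f) / eval q (pderiv 0 f) = lam at *
  generalize c * eval p (pderiv 1 f) / eval q (pderiv 1 f) = mu at *
  generalize c * eval p (pderiv 3 f) / eval q (pderiv 3 f) = nu at *
  by_cases hp1 : p 1 = 0
  · refine ⟨lam, nu / lam ^ r, hlam, div_ne_zero hnu (pow_ne_zero r hlam), h0, ?_, h2, ?_⟩
    · rw [h1, hp1, mul_zero, mul_zero]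
    · rw [mul_div_cancel₀ _ (pow_ne_zero r hlam), h3]
  · refine ⟨lam, mu, hlam, hmu, h0, h1, h2, ?_⟩
    have hnu_eq : nu = lam ^ r * mu := by
      rw [h0, h1, mul_pow] at h03
      rw [h2, h1, mul_pow] at h23
      by_cases hp0 : p 0 = 0
      · have hp2 : p 2 ≠ 0 := fun hp2 ↦ hp (by simp [Zexc, hp0, hp2])
        have hne : p 1 * p 2 ^ r ≠ 0 := mul_ne_zero hp1 (pow_ne_zero r hp2)
        exact mul_right_cancel₀ hne (by linear_combination -h23)
      · have hne : p 0 ^ r * p 1 ≠ 0 := mul_ne_zero (pow_ne_zero r hp0) hp1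
        exact mul_right_cancel₀ hne (by linear_combination -h03)
    rw [h3, hnu_eq]
end
end

section
/- Let r ≥ 0, β = (a,b) ample, and f ∈ S_β nondegenerate. If the genus of the curve {f = 0} ⊂ ℋ_r is at least 1, i.e., (b−1)·(2a − 2 − rb) ≥ 2, then x₁x₂x₃x₄ ∉ J₀(f). -/
open MvPolynomial

noncomputable section

lemma coeff_X_mul_pderiv (i : Fin 4) (f : S) (m : Fin 4 →₀ ℕ) :
    coeff m (X i * pderiv i f) = m i * coeff m f := by
  induction f using MvPolynomial.induction_on' with
  | monomial u c =>
    rw [X_mul_pderiv_monomial, coeff_smul, coeff_monomial, nsmul_eq_mul]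
    split_ifs with h
    · rw [h]
    · simp
  | add p q hp hq => rw [map_add, mul_add, coeff_add, coeff_add, hp, hq, mul_add]

/-- In degree `γ`, an element of the ideal generated by the `xᵢ∂f/∂xᵢ` with `f ∈ S_γ` only sees
the constant terms of its coefficients. -/
lemma coeff_mul_X_mul_pderiv {r : ℕ} {γ : ℤ × ℤ} {f : S} (hf : f ∈ Sgr r γ) (g : S) (i : Fin 4)
    (m : Fin 4 →₀ ℕ) (hm : ∀ n ≤ m, wdeg r n = γ → n = m) :
    coeff m (g * (X i * pderiv i f)) = coeff 0 g * (m i * coeff m f) := by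
  rw [coeff_mul, Finset.sum_eq_single (0, m)]
  · rw [coeff_X_mul_pderiv]
  · rintro ⟨u, v⟩ huv hne
    rw [Finset.HasAntidiagonal.mem_antidiagonal] at huv
    dsimp only at huv ⊢
    rw [coeff_X_mul_pderiv]
    by_cases hv : coeff v f = 0
    · simp [hv]
    · have hvm : v = m := hm v (huv ▸ le_add_self) (hf v (mem_support_iff.mpr hv))
      subst hvm
      exact absurd (by rw [add_eq_right.mp huv]) hne
  · intro h
    simp at h

lemma eq_of_le_of_wdeg_eq {r : ℕ} {n m : Fin 4 →₀ ℕ} (hle : n ≤ m)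
    (h : wdeg r n = wdeg r m) : n = m := by
  simp only [wdeg, Prod.mk.injEq] at h
  obtain ⟨h1, h2⟩ := h
  have l0 := hle 0
  have l1 := hle 1
  have l2 := hle 2
  have l3 := hle 3
  have e3 : n 3 = m 3 := by omega
  rw [e3] at h1
  ext i
  fin_cases i <;> simp only [Fin.zero_eta, Fin.mk_one, Fin.reduceFinMk] <;> omega

/-- Evaluating at a point outside `Z(Σ)` that kills every monomial of degree `γ` but one shows
that this monomial occurs in a nondegenerate `f ∈ S_γ`. -/
lemma Nondeg.coeff_ne_zero {r : ℕ} {γ : ℤ × ℤ} {f : S} (hnd : Nondeg f) (hf : f ∈ Sgr r γ)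
    (p : Fin 4 → ℂ) (hp : p ∉ Zexc) (m : Fin 4 →₀ ℕ)
    (hm : ∀ c, wdeg r c = γ → (∀ i, p i = 0 → c i = 0) → c = m) : coeff m f ≠ 0 := by
  intro h0
  obtain ⟨i, hi⟩ := hnd p hp
  apply hi
  rw [eval_eq']
  refine Finset.sum_eq_zero fun c _ => ?_
  rw [coeff_X_mul_pderiv]
  by_cases hc : coeff c f = 0
  · simp [hc]
  by_cases hz : ∀ i, p i = 0 → c i = 0
  · rw [hm c (hf c (mem_support_iff.mpr hc)) hz] at hc
    exact absurd h0 hc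
  · push Not at hz
    obtain ⟨j, hpj, hcj⟩ := hz
    rw [Finset.prod_eq_zero (Finset.mem_univ j) (by rw [hpj, zero_pow hcj]), mul_zero]

/-- The exponent vector with the given four entries. -/
def expo (c : Fin 4 → ℕ) : Fin 4 →₀ ℕ := Finsupp.equivFunOnFinite.symm c

@[simp] lemma expo_apply (c : Fin 4 → ℕ) (i : Fin 4) : expo c i = c i := rfl

lemma coeff_X_mul_X_mul_X_mul_X (m : Fin 4 →₀ ℕ) :
    coeff m (X 0 * X 1 * X 2 * X 3 : S) = if expo ![1, 1, 1, 1] = m then 1 else 0 := by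
  have h : (X 0 * X 1 * X 2 * X 3 : S) = monomial (expo ![1, 1, 1, 1]) 1 := by
    simp only [X, monomial_mul, mul_one]
    refine congrArg (monomial · 1) (Finsupp.ext fun i => ?_)
    fin_cases i <;> simp
  rw [h, coeff_monomial]

/-- If `x₁x₂x₃x₄ = ∑ gᵢ xᵢ∂f/∂xᵢ`, then the vector of constant terms of the `gᵢ` is orthogonal to
every exponent vector of `f` other than `(1,1,1,1)`. -/
lemma sum_coeff_zero_mul_eq_zero {r : ℕ} {γ : ℤ × ℤ} {f : S} (hf : f ∈ Sgr r γ) {g : Fin 4 → S}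
    (hg : ∑ i, g i * (X i * pderiv i f) = X 0 * X 1 * X 2 * X 3) {m : Fin 4 →₀ ℕ}
    (hm : coeff m f ≠ 0) (hne : m ≠ expo ![1, 1, 1, 1]) :
    ∑ i, coeff 0 (g i) * m i = 0 := by
  have h := congrArg (coeff m) hg
  rw [coeff_X_mul_X_mul_X_mul_X, if_neg hne.symm, coeff_sum] at h
  have hmγ := hf m (mem_support_iff.mpr hm)
  simp_rw [coeff_mul_X_mul_pderiv hf _ _ m fun n hle hn =>
    eq_of_le_of_wdeg_eq hle (hn.trans hmγ.symm), ← mul_assoc] at h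
  rw [← Finset.sum_mul] at h
  exact (mul_eq_zero.mp h).resolve_right hm

/-- for `β = (a,b)` ample and `f ∈ S_β` nondegenerate, if the genus
`(b−1)(a−1−rb/2)` of the curve `{f = 0}` is at least 1, i.e.
`(b−1)·(2a − 2 − rb) ≥ 2`, then `x₁x₂x₃x₄ ∉ J₀(f)`. -/
theorem stmt_17 (r : ℕ) (a b : ℤ) (hβ : (r : ℤ) * b < a ∧ 0 < b)
    (f : S) (hf : f ∈ Sgr r (a, b)) (hnd : Nondeg f)
    (hgenus : 2 ≤ (b - 1) * (2 * a - 2 - (r : ℤ) * b)) :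
    (X 0 * X 1 * X 2 * X 3 : S) ∉ J0 f := by
  intro hmem
  have hJ : J0 f = Ideal.span (Set.range fun i => X i * pderiv i f) := by
    unfold J0
    congr 1
    ext g
    simp [eq_comm]
  rw [hJ, Ideal.mem_span_range_iff_exists_fun] at hmem
  obtain ⟨g, hg⟩ := hmem
  obtain ⟨hab, hb⟩ := hβ
  have hb2 : 2 ≤ b := by
    by_contra hlt
    obtain rfl : b = 1 := by omega
    simp at hgenus
  have hsq : ∀ n ≤ expo ![1, 1, 1, 1], wdeg r n = (a, b) →
      b = 2 ∧ a = r + 2 ∧ n = expo ![1, 1, 1, 1] := by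
    intro n hle hn
    have l0 : n 0 ≤ 1 := hle 0
    have l1 : n 1 ≤ 1 := hle 1
    have l2 : n 2 ≤ 1 := hle 2
    have l3 : n 3 ≤ 1 := hle 3
    simp only [wdeg, Prod.mk.injEq] at hn
    obtain ⟨h1, h2⟩ := hn
    have e3 : n 3 = 1 := by omega
    have e1 : n 1 = 1 := by omega
    obtain rfl : b = 2 := by omega
    rw [e3] at h1
    refine ⟨rfl, by push_cast at h1; linarith, ?_⟩
    ext i
    fin_cases i <;> simp <;> omega
  have hone := congrArg (coeff (expo ![1, 1, 1, 1])) hg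
  rw [coeff_X_mul_X_mul_X_mul_X, if_pos rfl, coeff_sum] at hone
  simp_rw [coeff_mul_X_mul_pderiv hf _ _ _ fun n hle hn => (hsq n hle hn).2.2, ← mul_assoc] at hone
  rw [← Finset.sum_mul] at hone
  have hone' : coeff (expo ![1, 1, 1, 1]) f ≠ 0 := right_ne_zero_of_mul_eq_one hone
  obtain ⟨rfl, rfl, -⟩ := hsq _ le_rfl (hf _ (mem_support_iff.mpr hone'))
  have hr : r < 2 := by omega
  have corner : ∀ (p : Fin 4 → ℂ) (_ : p ∉ Zexc) (m : Fin 4 → ℕ) (_ : m ≠ ![1, 1, 1, 1])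
      (_ : ∀ c, wdeg r c = ((r : ℤ) + 2, 2) → (∀ i, p i = 0 → c i = 0) → c = expo m),
      ∑ i, coeff 0 (g i) * m i = 0 := fun p hp m hne hm =>
    sum_coeff_zero_mul_eq_zero (m := expo m) hf hg (hnd.coeff_ne_zero hf p hp (expo m) hm)
      fun h => hne (funext fun i => DFunLike.congr_fun h i)
  have h12 := corner ![1, 1, 0, 0] (by simp [Zexc]) ![r + 2, 2, 0, 0]
    (fun h => by simpa using congrFun h 1) fun c hc hz => by
      have z2 : c 2 = 0 := hz 2 (by simp)
      have z3 : c 3 = 0 := hz 3 (by simp)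
      simp only [wdeg, Prod.mk.injEq, z2, z3] at hc
      ext i
      fin_cases i <;> simp <;> omega
  have h32 := corner ![0, 1, 1, 0] (by simp [Zexc]) ![0, 2, r + 2, 0]
    (fun h => by simpa using congrFun h 1) fun c hc hz => by
      have z0 : c 0 = 0 := hz 0 (by simp)
      have z3 : c 3 = 0 := hz 3 (by simp)
      simp only [wdeg, Prod.mk.injEq, z0, z3] at hc
      ext i
      fin_cases i <;> simp <;> omega
  have h14 := corner ![1, 0, 0, 1] (by simp [Zexc]) ![2 - r, 0, 0, 2]
    (fun h => by simpa using congrFun h 1) fun c hc hz => by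
      have z1 : c 1 = 0 := hz 1 (by simp)
      have z2 : c 2 = 0 := hz 2 (by simp)
      simp only [wdeg, Prod.mk.injEq, z1, z2] at hc
      have e3 : c 3 = 2 := by omega
      rw [e3] at hc
      ext i
      fin_cases i <;> simp <;> omega
  have h34 := corner ![0, 0, 1, 1] (by simp [Zexc]) ![0, 0, 2 - r, 2]
    (fun h => by simpa using congrFun h 1) fun c hc hz => by
      have z0 : c 0 = 0 := hz 0 (by simp)
      have z1 : c 1 = 0 := hz 1 (by simp)
      simp only [wdeg, Prod.mk.injEq, z0, z1] at hc
      have e3 : c 3 = 2 := by omega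
      rw [e3] at hc
      ext i
      fin_cases i <;> simp <;> omega
  refine left_ne_zero_of_mul_eq_one hone ?_
  simp only [Fin.sum_univ_four, expo_apply] at h12 h32 h14 h34 ⊢
  simp only [Matrix.cons_val] at h12 h32 h14 h34 ⊢
  push_cast [Nat.cast_sub hr.le] at h12 h32 h14 h34 ⊢
  linear_combination (h12 + h32 + h14 + h34) / 4
end
end

section
/- Let λ ∈ ℂ and f = x²z² + x²w² + y²z² + y²w² + λ·xyzw ∈ ℂ[x,y,z,w]. The four polynomials x·∂f/∂x, y·∂f/∂y, z·∂f/∂z, w·∂f/∂w have a common zero p = (x,y,z,w) ∈ ℂ⁴ with (x,y) ≠ (0,0) and (z,w) ≠ (0,0) if and only if λ ∈ {0, 4, −4}. (Equivalently, the curve f = 0 of bidegree (2,2) on ℙ¹ × ℙ¹ is nondegenerate if and only if λ ≠ 0, ±4.) -/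
open MvPolynomial

/-- The parameters for which the explicit system of the four logarithmic partial derivatives of
`(x² + y²)(z² + w²) + l·xyzw` has a zero outside the exceptional set. -/
theorem parameter_of_common_zero {l x y z w : ℂ} (hxy : x ≠ 0 ∨ y ≠ 0) (hzw : z ≠ 0 ∨ w ≠ 0)
    (hx : 2 * x ^ 2 * (z ^ 2 + w ^ 2) + l * (x * y * z * w) = 0)
    (hy : 2 * y ^ 2 * (z ^ 2 + w ^ 2) + l * (x * y * z * w) = 0)
    (hz : 2 * z ^ 2 * (x ^ 2 + y ^ 2) + l * (x * y * z * w) = 0)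
    (hw : 2 * w ^ 2 * (x ^ 2 + y ^ 2) + l * (x * y * z * w) = 0) :
    l = 0 ∨ l = 4 ∨ l = -4 := by
  have ne_zero_of_sq_add : ∀ {a b : ℂ}, (a ≠ 0 ∨ b ≠ 0) → a ^ 2 + b ^ 2 = 0 → a ≠ 0 ∧ b ≠ 0 := by
    intro a b h hs
    constructor <;> rintro rfl <;> simp_all
  have ne_zero_of_sq_sub : ∀ {a b : ℂ}, (a ≠ 0 ∨ b ≠ 0) → a ^ 2 - b ^ 2 = 0 → a ≠ 0 ∧ b ≠ 0 := by
    intro a b h hs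
    constructor <;> rintro rfl <;> simp_all
  have sq_add_ne_zero : ∀ {a b : ℂ}, (a ≠ 0 ∨ b ≠ 0) → a ^ 2 - b ^ 2 = 0 → a ^ 2 + b ^ 2 ≠ 0 := by
    intro a b h hs hs'
    have ha : a ^ 2 = 0 := by linear_combination (hs + hs') / 2
    exact (ne_zero_of_sq_sub h hs).1 (pow_eq_zero_iff two_ne_zero |>.1 ha)
  have hdxy : (x ^ 2 - y ^ 2) * (z ^ 2 + w ^ 2) = 0 := by linear_combination (hx - hy) / 2
  have hdzw : (z ^ 2 - w ^ 2) * (x ^ 2 + y ^ 2) = 0 := by linear_combination (hz - hw) / 2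
  rcases mul_eq_zero.1 hdxy with hs | hs
  · have ht : z ^ 2 - w ^ 2 = 0 :=
      (mul_eq_zero.1 hdzw).resolve_right (sq_add_ne_zero hxy hs)
    obtain ⟨hx0, -⟩ := ne_zero_of_sq_sub hxy hs
    obtain ⟨hz0, -⟩ := ne_zero_of_sq_sub hzw ht
    have hy2 : y ^ 2 = x ^ 2 := by linear_combination -hs
    have hw2 : w ^ 2 = z ^ 2 := by linear_combination -ht
    have hm : l * (x * y * z * w) = -(4 * x ^ 2 * z ^ 2) := by
      rw [hw2] at hx
      linear_combination hx
    have hsq : (x ^ 4 * z ^ 4) * ((l - 4) * (l + 4)) = 0 := by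
      have h := congrArg (· ^ 2) hm
      simp only [mul_pow, hy2, hw2] at h
      linear_combination h
    have hl := (mul_eq_zero.1 hsq).resolve_left (by simp [hx0, hz0])
    rcases mul_eq_zero.1 hl with h | h
    · exact Or.inr (Or.inl (sub_eq_zero.1 h))
    · exact Or.inr (Or.inr (eq_neg_of_add_eq_zero_left h))
  · have ht : x ^ 2 + y ^ 2 = 0 :=
      (mul_eq_zero.1 hdzw).resolve_left fun h => sq_add_ne_zero hzw h hs
    obtain ⟨hx0, hy0⟩ := ne_zero_of_sq_add hxy ht
    obtain ⟨hz0, hw0⟩ := ne_zero_of_sq_add hzw hs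
    left
    simpa [hs, hx0, hy0, hz0, hw0] using hx

/-- on `ℙ¹ × ℙ¹` with Cox ring `ℂ[x,y,z,w]` (variables
`x,y,z,w ↦ X 0, X 1, X 2, X 3`), for
`f = x²z² + x²w² + y²z² + y²w² + λ·xyzw`, the polynomials
`x∂f/∂x, y∂f/∂y, z∂f/∂z, w∂f/∂w` have a common zero outside the exceptional set
(`(x,y) ≠ (0,0)` and `(z,w) ≠ (0,0)`) if and only if `λ ∈ {0, 4, −4}`;
i.e. `f` is nondegenerate iff `λ ≠ 0, ±4`. -/
theorem stmt_18 (l : ℂ) (f : MvPolynomial (Fin 4) ℂ)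
    (hf : f = X 0 ^ 2 * X 2 ^ 2 + X 0 ^ 2 * X 3 ^ 2 + X 1 ^ 2 * X 2 ^ 2
            + X 1 ^ 2 * X 3 ^ 2 + C l * (X 0 * X 1 * X 2 * X 3)) :
    (∃ p : Fin 4 → ℂ, (p 0 ≠ 0 ∨ p 1 ≠ 0) ∧ (p 2 ≠ 0 ∨ p 3 ≠ 0) ∧
        ∀ i : Fin 4, eval p (X i * pderiv i f) = 0)
      ↔ (l = 0 ∨ l = 4 ∨ l = -4) := by
  have hzero : ∀ p : Fin 4 → ℂ, (∀ i : Fin 4, eval p (X i * pderiv i f) = 0) ↔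
      (2 * p 0 ^ 2 * (p 2 ^ 2 + p 3 ^ 2) + l * (p 0 * p 1 * p 2 * p 3) = 0 ∧
        2 * p 1 ^ 2 * (p 2 ^ 2 + p 3 ^ 2) + l * (p 0 * p 1 * p 2 * p 3) = 0 ∧
        2 * p 2 ^ 2 * (p 0 ^ 2 + p 1 ^ 2) + l * (p 0 * p 1 * p 2 * p 3) = 0 ∧
        2 * p 3 ^ 2 * (p 0 ^ 2 + p 1 ^ 2) + l * (p 0 * p 1 * p 2 * p 3) = 0) := by
    intro p
    subst hf
    simp only [Fin.forall_fin_succ, IsEmpty.forall_iff, and_true]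
    refine and_congr ?_ (and_congr ?_ (and_congr ?_ ?_)) <;>
    · refine Eq.congr ?_ rfl
      simp [pderiv_X, Derivation.leibniz_pow]
      ring
  simp only [hzero]
  constructor
  · rintro ⟨p, hxy, hzw, hx, hy, hz, hw⟩
    exact parameter_of_common_zero hxy hzw hx hy hz hw
  · rintro (rfl | rfl | rfl)
    · exact ⟨![1, Complex.I, 1, Complex.I], by simp⟩
    · exact ⟨![1, 1, 1, -1], by simp; norm_num⟩
    · exact ⟨![1, 1, 1, 1], by simp; norm_num⟩
end
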